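/- arXiv:2604.13798 — 2 statements merged into one kernel-verified Lean document; each statement's English description precedes it below -/
import Mathlib

section
/- With the CGMY data below, the function L satisfies lim_{t→0⁺} L(t) = d₁, where d₁ = (1/π)·Γ(1 - 1/Y)·σ_Y^(1/Y). (This is the first-order at-the-money call price asymptotic c(t,0) = d₁·t^{1/Y} + o(t^{1/Y}) expressed through the Lipton–Lewis representation c(t,0) = t^{1/Y}·L(t).) -/
open MeasureTheory Filter Topology Complex

/-- The stable scale coefficient `σ_Y = 2·C·Γ(-Y)·|cos(πY/2)|`. -/
noncomputable def sigmaY (C Y : ℝ) : ℝ :=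
  2 * C * Real.Gamma (-Y) * |Real.cos (Real.pi * Y / 2)|

/-- The martingale drift `b̃`. -/
noncomputable def btilde (C G M Y : ℝ) : ℝ :=
  -(C * Real.Gamma (-Y) * ((M - 1) ^ Y + (G + 1) ^ Y - M ^ Y - G ^ Y))

/-- The constant `κ = b̃/2 - C·Γ(-Y)·(M^Y + G^Y)`. -/
noncomputable def kappaC (C G M Y : ℝ) : ℝ :=
  btilde C G M Y / 2 - C * Real.Gamma (-Y) * (M ^ Y + G ^ Y)

/-- The limiting stable exponent `θ₀(u) = -σ_Y·|u|^Y`. -/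
noncomputable def theta0 (C Y : ℝ) (u : ℝ) : ℝ :=
  -(sigmaY C Y) * |u| ^ Y

/-- The contour-shifted characteristic exponent `ψ₀`. -/
noncomputable def psi0 (C G M Y : ℝ) (v : ℝ) : ℂ :=
  Complex.I * (v : ℂ) * ((btilde C G M Y : ℝ) : ℂ) + ((kappaC C G M Y : ℝ) : ℂ)
    + ((C * Real.Gamma (-Y) : ℝ) : ℂ) *
      ((((M - 1/2 : ℝ) : ℂ) - Complex.I * (v : ℂ)) ^ (Y : ℂ)
        + (((G + 1/2 : ℝ) : ℂ) + Complex.I * (v : ℂ)) ^ (Y : ℂ))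

/-- The rescaled exponent `θ(t,v)` in the Lipton–Lewis representation. -/
noncomputable def thetaT (C G M Y : ℝ) (t v : ℝ) : ℂ :=
  Complex.I * (v : ℂ) * ((btilde C G M Y : ℝ) : ℂ) * ((t ^ (1 - 1/Y) : ℝ) : ℂ)
    + ((kappaC C G M Y : ℝ) : ℂ) * (t : ℂ)
    + ((C * Real.Gamma (-Y) : ℝ) : ℂ) *
      (((((M - 1/2) * t ^ (1/Y) : ℝ) : ℂ) - Complex.I * (v : ℂ)) ^ (Y : ℂ)
        + ((((G + 1/2) * t ^ (1/Y) : ℝ) : ℂ) + Complex.I * (v : ℂ)) ^ (Y : ℂ))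

/-- The normalized Lipton–Lewis ATM factor `L(t)`. -/
noncomputable def LLfn (C G M Y : ℝ) (t : ℝ) : ℝ :=
  (1 / Real.pi) *
    (∫ v in Set.Ioi (0 : ℝ),
      (1 - Complex.exp (thetaT C G M Y t v)) / (((v ^ 2 + t ^ (2/Y) / 4 : ℝ)) : ℂ)).re

/-- The first-order coefficient `d₁`. -/
noncomputable def dOne (C Y : ℝ) : ℝ :=
  (1 / Real.pi) * Real.Gamma (1 - 1/Y) * (sigmaY C Y) ^ (1/Y)

/-- The second-order coefficient `d₂`. -/
noncomputable def dTwo (C G M Y : ℝ) : ℝ :=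
  (1 / Real.pi) * ∫ w in Set.Ioi (0 : ℝ),
    ((w ^ 2 + 1/4) * theta0 C Y w - w ^ 2 * (psi0 C G M Y w).re) / (w ^ 2 * (w ^ 2 + 1/4))

/-- The Gamma function is positive on `(-2, -1)`. -/
lemma Gamma_neg_pos_of_mem_Ioo {Y : ℝ} (hY1 : 1 < Y) (hY2 : Y < 2) : 0 < Real.Gamma (-Y) := by
  have h1 := Real.Gamma_add_one (s := -Y) (by linarith)
  have h2 := Real.Gamma_add_one (s := -Y + 1) (by linarith)
  have h3 : 0 < Real.Gamma (-Y + 1 + 1) := Real.Gamma_pos_of_pos (by linarith)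
  rw [h2, h1, ← mul_assoc] at h3
  exact pos_of_mul_pos_right h3 (by nlinarith)

lemma cos_pi_mul_div_two_neg {Y : ℝ} (hY1 : 1 < Y) (hY2 : Y < 2) :
    Real.cos (Real.pi * Y / 2) < 0 := by
  have := Real.pi_pos
  exact Real.cos_neg_of_pi_div_two_lt_of_lt (by nlinarith) (by nlinarith)

lemma sigmaY_pos {C Y : ℝ} (hC : 0 < C) (hY1 : 1 < Y) (hY2 : Y < 2) : 0 < sigmaY C Y := by
  have h1 := Gamma_neg_pos_of_mem_Ioo hY1 hY2
  have h2 := abs_pos.2 (cos_pi_mul_div_two_neg hY1 hY2).ne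
  unfold sigmaY
  positivity

lemma norm_one_sub_exp_le_mul_exp (z : ℂ) : ‖1 - Complex.exp z‖ ≤ ‖z‖ * Real.exp ‖z‖ := by
  have := Complex.norm_exp_sub_sum_le_norm_mul_exp z 1
  rw [norm_sub_rev]
  simpa using this

/-- The dominating function: `v ^ (Y - 2)` near the origin and `v ^ (-2)` at infinity. -/
lemma integrableOn_ite_rpow {Y : ℝ} (hY1 : 1 < Y) (A B : ℝ) :
    IntegrableOn (fun v : ℝ => if v ≤ 1 then A * v ^ (Y - 2) else B * v ^ (-2 : ℝ))
      (Set.Ioi 0) := by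
  rw [← Set.Ioc_union_Ioi_eq_Ioi zero_le_one]
  refine IntegrableOn.union ?_ ?_
  · have h : IntegrableOn (fun v : ℝ => A * v ^ (Y - 2)) (Set.Ioc 0 1) := by
      have := intervalIntegral.intervalIntegrable_rpow' (a := 0) (b := 1) (r := Y - 2)
        (by linarith)
      rw [intervalIntegrable_iff_integrableOn_Ioc_of_le zero_le_one] at this
      exact this.const_mul A
    exact h.congr_fun (fun v hv => by simp [hv.2]) measurableSet_Ioc
  · have h : IntegrableOn (fun v : ℝ => B * v ^ (-2 : ℝ)) (Set.Ioi 1) :=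
      (integrableOn_Ioi_rpow_of_lt (by norm_num) one_pos).const_mul B
    exact h.congr_fun (fun v hv => by simp [not_le.2 (Set.mem_Ioi.1 hv)]) measurableSet_Ioi

lemma one_sub_exp_neg_mul_rpow_mem {s Y x : ℝ} (hs : 0 < s) (hx : 0 ≤ x) :
    0 ≤ 1 - Real.exp (-s * x ^ Y) ∧ 1 - Real.exp (-s * x ^ Y) ≤ 1 ∧
      1 - Real.exp (-s * x ^ Y) ≤ s * x ^ Y := by
  have h : 0 ≤ s * x ^ Y := by positivity
  refine ⟨?_, ?_, ?_⟩
  · have : Real.exp (-s * x ^ Y) ≤ 1 := Real.exp_le_one_iff.2 (by linarith)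
    linarith
  · linarith [Real.exp_pos (-s * x ^ Y)]
  · linarith [Real.add_one_le_exp (-s * x ^ Y)]

lemma integrableOn_one_sub_exp_neg_mul_rpow_div_sq {s Y : ℝ} (hs : 0 < s) (hY1 : 1 < Y) :
    IntegrableOn (fun x : ℝ => (1 - Real.exp (-s * x ^ Y)) / x ^ 2) (Set.Ioi 0) := by
  refine Integrable.mono' (integrableOn_ite_rpow hY1 s 1)
    (by fun_prop : Measurable _).aestronglyMeasurable ?_
  filter_upwards [ae_restrict_mem measurableSet_Ioi] with x hx
  have hx : 0 < x := hx
  obtain ⟨h0, h1, h2⟩ := one_sub_exp_neg_mul_rpow_mem (Y := Y) hs hx.le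
  rw [Real.norm_of_nonneg (by positivity)]
  split_ifs
  · rw [Real.rpow_sub hx, Real.rpow_two, ← mul_div_assoc]
    gcongr
  · rw [Real.rpow_neg hx.le, Real.rpow_two, ← div_eq_mul_inv]
    gcongr

/-- Integration by parts reduces this integral to a Gamma integral. -/
lemma integral_one_sub_exp_neg_mul_rpow_div_sq {s Y : ℝ} (hs : 0 < s) (hY1 : 1 < Y) :
    ∫ x in Set.Ioi (0 : ℝ), (1 - Real.exp (-s * x ^ Y)) / x ^ 2
      = Real.Gamma (1 - 1 / Y) * s ^ (1 / Y) := by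
  have hY0 : 0 < Y := by linarith
  have hint1 := integrableOn_one_sub_exp_neg_mul_rpow_div_sq hs hY1
  have hint2 : IntegrableOn (fun x : ℝ => s * Y * (x ^ (Y - 2) * Real.exp (-s * x ^ Y)))
      (Set.Ioi 0) :=
    (integrableOn_rpow_mul_exp_neg_mul_rpow (by linarith) hY0 hs).const_mul (s * Y)
  have hderiv : ∀ x ∈ Set.Ioi (0 : ℝ), HasDerivAt (fun x => -((1 - Real.exp (-s * x ^ Y)) / x))
      ((1 - Real.exp (-s * x ^ Y)) / x ^ 2
        - s * Y * (x ^ (Y - 2) * Real.exp (-s * x ^ Y))) x := by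
    intro x hx
    have hx : 0 < x := hx
    have h1 := (((Real.hasDerivAt_rpow_const (p := Y) (Or.inl hx.ne')).const_mul (-s)).exp.const_sub
      1).div (hasDerivAt_id x) hx.ne' |>.neg
    refine h1.congr_deriv ?_
    have e : x ^ (Y - 1) = x ^ (Y - 2) * x := by
      rw [← Real.rpow_add_one hx.ne']; congr 1; ring
    simp only [id, e]
    field_simp
    ring
  have hcont : ContinuousWithinAt (fun x => -((1 - Real.exp (-s * x ^ Y)) / x)) (Set.Ici 0) 0 := by
    have hlim : Tendsto (fun x : ℝ => s * x ^ (Y - 1)) (𝓝[≥] 0) (𝓝 0) := by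
      have : ContinuousAt (fun x : ℝ => s * x ^ (Y - 1)) 0 :=
        (Real.continuousAt_rpow_const 0 (Y - 1) (Or.inr (by linarith))).const_mul s
      have := this.tendsto
      rw [Real.zero_rpow (by linarith), mul_zero] at this
      exact this.mono_left nhdsWithin_le_nhds
    unfold ContinuousWithinAt
    simp only [div_zero, neg_zero]
    refine squeeze_zero_norm' ?_ hlim
    filter_upwards [self_mem_nhdsWithin] with x hx
    have hx : 0 ≤ x := hx
    obtain ⟨h0, -, h2⟩ := one_sub_exp_neg_mul_rpow_mem (Y := Y) hs hx
    rw [norm_neg, Real.norm_of_nonneg (by positivity)]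
    rcases hx.eq_or_lt with rfl | hx
    · simp [Real.zero_rpow (by linarith : Y - 1 ≠ 0)]
    · rw [Real.rpow_sub_one hx.ne', ← mul_div_assoc]
      gcongr
  have htop : Tendsto (fun x => -((1 - Real.exp (-s * x ^ Y)) / x)) atTop (𝓝 0) := by
    refine squeeze_zero_norm' ?_ tendsto_inv_atTop_zero
    filter_upwards [eventually_gt_atTop 0] with x hx
    obtain ⟨h0, h1, -⟩ := one_sub_exp_neg_mul_rpow_mem (Y := Y) hs hx.le
    rw [norm_neg, Real.norm_of_nonneg (by positivity), ← one_div]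
    gcongr
  have h := integral_Ioi_of_hasDerivAt_of_tendsto hcont hderiv (hint1.sub hint2) htop
  rw [integral_sub hint1 hint2, integral_const_mul,
    _root_.integral_rpow_mul_exp_neg_mul_rpow hY0 (by linarith) hs, div_zero, neg_zero, sub_zero,
    sub_eq_zero] at h
  rw [h]
  have e1 : (Y - 2 + 1) / Y = 1 - 1 / Y := by field_simp; ring
  have e2 : -(Y - 2 + 1) / Y = 1 / Y - 1 := by field_simp; ring
  rw [e1, e2, Real.rpow_sub_one hs.ne']
  field_simp

/-- For small `ε` the argument of `a * ε ± i v` is close to `± π / 2` uniformly in `v ≥ 1`. -/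
lemma eventually_re_cpow_nonpos {Y : ℝ} (hY1 : 1 < Y) (hY2 : Y < 2) (a : ℝ) {s : ℝ}
    (hs : s = 1 ∨ s = -1) :
    ∀ᶠ ε in 𝓝 (0 : ℝ), ∀ v : ℝ, 1 ≤ v →
      ((((a * ε : ℝ) : ℂ) + s * (I * v)) ^ (Y : ℂ)).re ≤ 0 := by
  have harg : Complex.arg (s * I) = s * (Real.pi / 2) := by
    rcases hs with rfl | rfl
    · simp
    · simp
  have hslit : ((0 : ℝ) : ℂ) + s * I ∈ slitPlane := by
    rw [mem_slitPlane_iff]; right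
    rcases hs with rfl | rfl <;> simp
  have hcont : ContinuousAt (fun w : ℝ => Real.cos (Complex.arg ((w : ℂ) + s * I) * Y)) 0 := by
    have h1 : ContinuousAt (fun w : ℝ => Complex.arg ((w : ℂ) + s * I)) 0 :=
      (continuousAt_arg hslit).comp (f := fun w : ℝ => (w : ℂ) + s * I) (by fun_prop)
    fun_prop
  have hneg : Real.cos (Complex.arg (((0 : ℝ) : ℂ) + s * I) * Y) < 0 := by
    rw [ofReal_zero, zero_add, harg]
    refine lt_of_eq_of_lt ?_ (cos_pi_mul_div_two_neg hY1 hY2)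
    rcases hs with rfl | rfl
    · ring_nf
    · rw [← Real.cos_neg]; ring_nf
  obtain ⟨δ, hδ, hball⟩ := Metric.eventually_nhds_iff.1 (hcont.eventually (gt_mem_nhds hneg))
  have hsmall : ∀ᶠ ε in 𝓝 (0 : ℝ), |a * ε| < δ := by
    have : ContinuousAt (fun ε : ℝ => |a * ε|) 0 := by fun_prop
    exact this.eventually (gt_mem_nhds (by simpa using hδ))
  filter_upwards [hsmall] with ε hε v hv
  have hv0 : 0 < v := by linarith
  have hw : |a * ε / v| < δ := by
    rw [abs_div, abs_of_pos hv0]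
    exact (div_le_self (abs_nonneg _) hv).trans_lt hε
  have h := hball (y := a * ε / v) (by rwa [Real.dist_eq, sub_zero])
  have hz : ((a * ε : ℝ) : ℂ) + s * (I * v) = (v : ℂ) * (((a * ε / v : ℝ) : ℂ) + s * I) := by
    have : (v : ℂ) ≠ 0 := by exact_mod_cast hv0.ne'
    push_cast
    field_simp
  rw [cpow_ofReal_re, hz, arg_real_mul _ hv0]
  exact mul_nonpos_of_nonneg_of_nonpos (by positivity) h.le

lemma thetaT_eq (C G M Y t v : ℝ) : thetaT C G M Y t v =
    I * v * btilde C G M Y * (t ^ (1 - 1 / Y) : ℝ) + kappaC C G M Y * t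
      + (C * Real.Gamma (-Y) : ℝ) *
        ((((M - 1 / 2) * t ^ (1 / Y) : ℝ) + ((-1 : ℝ) : ℂ) * (I * v)) ^ (Y : ℂ)
          + (((G + 1 / 2) * t ^ (1 / Y) : ℝ) + ((1 : ℝ) : ℂ) * (I * v)) ^ (Y : ℂ)) := by
  unfold thetaT
  simp only [ofReal_neg, ofReal_one, neg_mul, one_mul, ← sub_eq_add_neg]

lemma tendsto_rpow_nhdsGT_zero {p : ℝ} (hp : 0 < p) :
    Tendsto (fun t : ℝ => t ^ p) (𝓝[>] 0) (𝓝 0) := by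
  have := (Real.continuousAt_rpow_const 0 p (Or.inr hp.le)).tendsto
  rw [Real.zero_rpow hp.ne'] at this
  exact this.mono_left nhdsWithin_le_nhds

lemma neg_I_mul_cpow_add_I_mul_cpow {Y v : ℝ} (hv : 0 < v) :
    (((-1 : ℝ) : ℂ) * (I * v)) ^ (Y : ℂ) + (((1 : ℝ) : ℂ) * (I * v)) ^ (Y : ℂ)
      = ((2 * v ^ Y * Real.cos (Real.pi * Y / 2) : ℝ) : ℂ) := by
  have e1 : ((-1 : ℝ) : ℂ) * (I * v) = v * (-I) := by push_cast; ring
  have e2 : ((1 : ℝ) : ℂ) * (I * v) = v * I := by push_cast; ring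
  rw [e1, e2]
  apply Complex.ext
  · rw [add_re, cpow_ofReal_re, cpow_ofReal_re, arg_real_mul _ hv, arg_real_mul _ hv, arg_I,
      arg_neg_I, ofReal_re, neg_mul, Real.cos_neg]
    simp [abs_of_pos hv]
    ring_nf
  · rw [add_im, cpow_ofReal_im, cpow_ofReal_im, arg_real_mul _ hv, arg_real_mul _ hv, arg_I,
      arg_neg_I, ofReal_im, neg_mul, Real.sin_neg]
    simp

lemma tendsto_thetaT {C G M Y v : ℝ} (hY1 : 1 < Y) (hY2 : Y < 2) (hv : 0 < v) :
    Tendsto (fun t : ℝ => thetaT C G M Y t v) (𝓝[>] 0) (𝓝 ((-sigmaY C Y * v ^ Y : ℝ) : ℂ)) := by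
  have hY0 : 0 < Y := by linarith
  have hd : 1 / Y < 1 := by rw [div_lt_one hY0]; exact hY1
  have h1 : Tendsto (fun t : ℝ => ((t ^ (1 - 1 / Y) : ℝ) : ℂ)) (𝓝[>] 0) (𝓝 ((0 : ℝ) : ℂ)) :=
    (continuous_ofReal.tendsto _).comp (tendsto_rpow_nhdsGT_zero (by linarith))
  have h2 : Tendsto (fun t : ℝ => (t : ℂ)) (𝓝[>] 0) (𝓝 ((0 : ℝ) : ℂ)) :=
    (continuous_ofReal.tendsto _).mono_left nhdsWithin_le_nhds
  have h3 : ∀ a s : ℝ, s ≠ 0 → Tendsto (fun t : ℝ =>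
      (((a * t ^ (1 / Y) : ℝ) : ℂ) + (s : ℂ) * (I * v)) ^ (Y : ℂ)) (𝓝[>] 0)
      (𝓝 (((s : ℂ) * (I * v)) ^ (Y : ℂ))) := by
    intro a s hs
    have hslit : (s : ℂ) * (I * v) ∈ slitPlane := by
      rw [mem_slitPlane_iff]; right
      simp [hs, hv.ne']
    have : Tendsto (fun t : ℝ => ((a * t ^ (1 / Y) : ℝ) : ℂ) + (s : ℂ) * (I * v)) (𝓝[>] 0)
        (𝓝 (((a * 0 : ℝ) : ℂ) + (s : ℂ) * (I * v))) :=
      ((continuous_ofReal.tendsto _).comp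
        ((tendsto_rpow_nhdsGT_zero (by positivity)).const_mul a)).add_const _
    rw [mul_zero, ofReal_zero, zero_add] at this
    exact (continuousAt_cpow_const hslit).tendsto.comp this
  simp only [thetaT_eq]
  have := ((h1.const_mul (I * v * btilde C G M Y)).add (h2.const_mul (kappaC C G M Y : ℂ))).add
    (((h3 (M - 1 / 2) (-1) (by norm_num)).add (h3 (G + 1 / 2) 1 one_ne_zero)).const_mul
      ((C * Real.Gamma (-Y) : ℝ) : ℂ))
  rw [neg_I_mul_cpow_add_I_mul_cpow hv, ofReal_zero, mul_zero, mul_zero, add_zero, zero_add,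
    ← ofReal_mul] at this
  convert this using 3
  rw [sigmaY, abs_of_neg (cos_pi_mul_div_two_neg hY1 hY2)]
  ring

lemma norm_add_I_mul_cpow_le {Y a ε v s : ℝ} (hY0 : 0 < Y) (ha : 0 ≤ a) (hε : 0 ≤ ε) (hv : 0 ≤ v)
    (hs : s = 1 ∨ s = -1) :
    ‖(((a * ε : ℝ) : ℂ) + s * (I * v)) ^ (Y : ℂ)‖ ≤ (a + 1) ^ Y * (v + ε) ^ Y := by
  rw [norm_cpow_real, ← Real.mul_rpow (by linarith) (by linarith)]
  refine Real.rpow_le_rpow (norm_nonneg _) ((norm_add_le _ _).trans ?_) hY0.le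
  have h1 : ‖(s : ℂ) * (I * v)‖ = v := by
    rcases hs with rfl | rfl <;> simp [abs_of_nonneg hv]
  rw [h1, norm_real, Real.norm_of_nonneg (by positivity)]
  nlinarith [mul_nonneg ha hv]

/-- `‖θ(t, v)‖` is at most a constant times `(v + t ^ (1 / Y)) ^ Y`. -/
lemma exists_norm_thetaT_le {C G M Y : ℝ} (hC : 0 < C) (hG : 0 ≤ G) (hM : 1 < M)
    (hY1 : 1 < Y) (hY2 : Y < 2) :
    ∃ K, 0 ≤ K ∧ ∀ t v : ℝ, 0 < t → 0 < v →
      ‖thetaT C G M Y t v‖ ≤ K * (v + t ^ (1 / Y)) ^ Y := by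
  have hY0 : 0 < Y := by linarith
  have hc : 0 < C * Real.Gamma (-Y) := mul_pos hC (Gamma_neg_pos_of_mem_Ioo hY1 hY2)
  have hM' : 0 ≤ M - 1 / 2 := by linarith
  refine ⟨|btilde C G M Y| + |kappaC C G M Y| +
    C * Real.Gamma (-Y) * ((M - 1 / 2 + 1) ^ Y + (G + 1 / 2 + 1) ^ Y), by positivity, ?_⟩
  intro t v ht hv
  set ε := t ^ (1 / Y) with hε
  have hε0 : 0 < ε := by positivity
  have e1 : t ^ (1 - 1 / Y) = ε ^ (Y - 1) := by
    rw [hε, ← Real.rpow_mul ht.le]; congr 1; field_simp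
  have e2 : t = ε ^ Y := by
    rw [hε, ← Real.rpow_mul ht.le, one_div_mul_cancel hY0.ne', Real.rpow_one]
  have b1 : v * ε ^ (Y - 1) ≤ (v + ε) ^ Y := by
    have : (v + ε) ^ Y = (v + ε) * (v + ε) ^ (Y - 1) := by
      rw [mul_comm, ← Real.rpow_add_one (by positivity)]; congr 1; ring
    rw [this]
    exact mul_le_mul (by linarith) (Real.rpow_le_rpow hε0.le (by linarith) (by linarith))
      (by positivity) (by positivity)
  have b2 : t ≤ (v + ε) ^ Y := by
    rw [e2]; exact Real.rpow_le_rpow hε0.le (by linarith) hY0.le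
  have n1 : ‖I * v * btilde C G M Y * (t ^ (1 - 1 / Y) : ℝ)‖
      ≤ |btilde C G M Y| * (v + ε) ^ Y := by
    rw [e1, norm_mul, norm_mul, norm_mul, norm_I, norm_real, norm_real, norm_real,
      Real.norm_of_nonneg hv.le, Real.norm_eq_abs (btilde C G M Y),
      Real.norm_of_nonneg (by positivity)]
    calc _ = |btilde C G M Y| * (v * ε ^ (Y - 1)) := by ring
      _ ≤ _ := by gcongr
  have n2 : ‖(kappaC C G M Y : ℂ) * t‖ ≤ |kappaC C G M Y| * (v + ε) ^ Y := by
    rw [norm_mul, norm_real, norm_real, Real.norm_of_nonneg ht.le, Real.norm_eq_abs]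
    gcongr
  have n3 := norm_add_I_mul_cpow_le hY0 hM' hε0.le hv.le (Or.inr rfl)
  have n4 := norm_add_I_mul_cpow_le (a := G + 1 / 2) hY0 (by linarith) hε0.le hv.le (Or.inl rfl)
  rw [thetaT_eq, add_mul _ _ ((v + ε) ^ Y), add_mul _ _ ((v + ε) ^ Y)]
  refine (norm_add₃_le).trans (add_le_add (add_le_add n1 n2) ?_)
  rw [norm_mul, norm_real, Real.norm_of_nonneg hc.le, mul_assoc (C * Real.Gamma (-Y)),
    add_mul _ _ ((v + ε) ^ Y)]
  gcongr
  exact (norm_add_le _ _).trans (add_le_add n3 n4)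

lemma eventually_re_thetaT_le {C G M Y : ℝ} (hC : 0 < C) (hY1 : 1 < Y) (hY2 : Y < 2) :
    ∀ᶠ t in 𝓝[>] (0 : ℝ), ∀ v : ℝ, 1 ≤ v → (thetaT C G M Y t v).re ≤ |kappaC C G M Y| := by
  have hc : 0 < C * Real.Gamma (-Y) := mul_pos hC (Gamma_neg_pos_of_mem_Ioo hY1 hY2)
  have hε : Tendsto (fun t : ℝ => t ^ (1 / Y)) (𝓝[>] 0) (𝓝 0) :=
    tendsto_rpow_nhdsGT_zero (by positivity)
  filter_upwards [hε.eventually (eventually_re_cpow_nonpos hY1 hY2 (M - 1 / 2) (Or.inr rfl)),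
    hε.eventually (eventually_re_cpow_nonpos hY1 hY2 (G + 1 / 2) (Or.inl rfl)),
    self_mem_nhdsWithin, nhdsWithin_le_nhds (Iic_mem_nhds one_pos)] with t h1 h2 ht0 ht1 v hv
  have ht0 : 0 < t := ht0
  have ht1 : t ≤ 1 := ht1
  have e : (I * v * btilde C G M Y * (t ^ (1 - 1 / Y) : ℝ) : ℂ).re = 0 := by
    rw [mul_assoc, mul_assoc, ← ofReal_mul, ← ofReal_mul, I_mul_re, ofReal_im, neg_zero]
  rw [thetaT_eq, add_re, add_re, e, ← ofReal_mul, ofReal_re, re_ofReal_mul, add_re, zero_add]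
  have k : kappaC C G M Y * t ≤ |kappaC C G M Y| :=
    calc _ ≤ |kappaC C G M Y| * t := by gcongr; exact le_abs_self _
      _ ≤ _ := mul_le_of_le_one_right (abs_nonneg _) ht1
  have := mul_nonpos_of_nonneg_of_nonpos hc.le (add_nonpos (h1 v hv) (h2 v hv))
  linarith

lemma exists_integrand_bound {C G M Y : ℝ} (hC : 0 < C) (hG : 0 ≤ G) (hM : 1 < M)
    (hY1 : 1 < Y) (hY2 : Y < 2) :
    ∃ A B : ℝ, ∀ᶠ t in 𝓝[>] (0 : ℝ), ∀ v : ℝ, 0 < v →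
      ‖(1 - Complex.exp (thetaT C G M Y t v)) / (((v ^ 2 + t ^ (2 / Y) / 4 : ℝ)) : ℂ)‖
        ≤ if v ≤ 1 then A * v ^ (Y - 2) else B * v ^ (-2 : ℝ) := by
  obtain ⟨K, hK, hθ⟩ := exists_norm_thetaT_le hC hG hM hY1 hY2
  have hY0 : 0 < Y := by linarith
  refine ⟨8 * (K * Real.exp (K * 2 ^ Y)), 1 + Real.exp |kappaC C G M Y|, ?_⟩
  filter_upwards [eventually_re_thetaT_le (G := G) (M := M) hC hY1 hY2,
    self_mem_nhdsWithin, nhdsWithin_le_nhds (Iic_mem_nhds one_pos)] with t hre ht0 ht1 v hv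
  have ht0 : 0 < t := ht0
  have ht1 : t ≤ 1 := ht1
  have e : t ^ (2 / Y) = (t ^ (1 / Y)) ^ 2 := by
    rw [← Real.rpow_natCast, ← Real.rpow_mul ht0.le]; congr 1; push_cast; ring
  rw [norm_div, norm_real, Real.norm_of_nonneg (by positivity), e]
  have hθ := hθ t v ht0 hv
  have hε1 : t ^ (1 / Y) ≤ 1 := Real.rpow_le_one ht0.le ht1 (by positivity)
  set ε := t ^ (1 / Y) with hε
  have hε0 : 0 < ε := by positivity
  split_ifs with hv1
  · have hden : (v + ε) ^ 2 / 8 ≤ v ^ 2 + ε ^ 2 / 4 := by nlinarith [sq_nonneg (v - ε)]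
    have hs2 : (v + ε) ^ Y ≤ 2 ^ Y := Real.rpow_le_rpow (by positivity) (by linarith) hY0.le
    have hnum : ‖1 - Complex.exp (thetaT C G M Y t v)‖
        ≤ K * (v + ε) ^ Y * Real.exp (K * 2 ^ Y) := by
      refine (norm_one_sub_exp_le_mul_exp _).trans ?_
      have : ‖thetaT C G M Y t v‖ ≤ K * 2 ^ Y := hθ.trans (by gcongr)
      gcongr
    calc _ ≤ K * (v + ε) ^ Y * Real.exp (K * 2 ^ Y) / ((v + ε) ^ 2 / 8) := by gcongr
      _ = 8 * (K * Real.exp (K * 2 ^ Y)) * (v + ε) ^ (Y - 2) := by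
        rw [Real.rpow_sub (by positivity), Real.rpow_two]
        field_simp
      _ ≤ _ := by
        gcongr ?_ * ?_
        exact Real.rpow_le_rpow_of_nonpos hv (by linarith) (by linarith)
  · have hnum : ‖1 - Complex.exp (thetaT C G M Y t v)‖ ≤ 1 + Real.exp |kappaC C G M Y| := by
      refine (norm_sub_le _ _).trans ?_
      rw [norm_one, norm_exp]
      gcongr
      exact hre v (not_le.1 hv1).le
    rw [Real.rpow_neg hv.le, Real.rpow_two, ← div_eq_mul_inv]
    gcongr
    have := sq_nonneg ε
    linarith

/-- First-order ATM asymptotics: `lim_{t→0⁺} L(t) = d₁`. -/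
theorem stmt1 (C G M Y : ℝ) (hC : 0 < C) (hG : 0 ≤ G) (hM : 1 < M)
    (hY1 : 1 < Y) (hY2 : Y < 2) :
    Tendsto (fun t : ℝ => LLfn C G M Y t) (𝓝[>] 0) (𝓝 (dOne C Y)) := by
  have hY0 : 0 < Y := by linarith
  obtain ⟨A, B, hAB⟩ := exists_integrand_bound hC hG hM hY1 hY2
  have hlim : Tendsto (fun t : ℝ => ∫ v in Set.Ioi (0 : ℝ),
      (1 - Complex.exp (thetaT C G M Y t v)) / (((v ^ 2 + t ^ (2 / Y) / 4 : ℝ)) : ℂ)) (𝓝[>] 0)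
      (𝓝 (∫ v in Set.Ioi (0 : ℝ),
        (((1 - Real.exp (-sigmaY C Y * v ^ Y)) / v ^ 2 : ℝ) : ℂ))) := by
    refine tendsto_integral_filter_of_dominated_convergence _ ?_ ?_
      (integrableOn_ite_rpow hY1 A B) ?_
    · refine Eventually.of_forall fun t => Measurable.aestronglyMeasurable ?_
      unfold thetaT
      fun_prop
    · filter_upwards [hAB] with t ht
      filter_upwards [ae_restrict_mem measurableSet_Ioi] with v hv using ht v hv
    · filter_upwards [ae_restrict_mem measurableSet_Ioi] with v hv
      have hv : 0 < v := hv
      have hden : Tendsto (fun t : ℝ => ((v ^ 2 + t ^ (2 / Y) / 4 : ℝ) : ℂ)) (𝓝[>] 0)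
          (𝓝 ((v ^ 2 + 0 / 4 : ℝ) : ℂ)) :=
        (continuous_ofReal.tendsto _).comp
          (((tendsto_rpow_nhdsGT_zero (by positivity)).div_const 4).const_add _)
      rw [zero_div, add_zero] at hden
      have hnum := ((continuous_exp.tendsto _).comp
        (tendsto_thetaT (C := C) (G := G) (M := M) hY1 hY2 hv)).const_sub 1
      have h := hnum.div hden (by exact_mod_cast (pow_pos hv 2).ne')
      rw [← ofReal_exp, ← ofReal_one, ← ofReal_sub, ← ofReal_div] at h
      exact h
  have h := ((continuous_re.tendsto _).comp hlim).const_mul (1 / Real.pi)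
  rw [integral_complex_ofReal, ofReal_re,
    integral_one_sub_exp_neg_mul_rpow_div_sq (sigmaY_pos hC hY1 hY2) hY1, ← mul_assoc] at h
  exact h
end

section
/- Let Y ∈ (1,2), M ≥ 0, and u ∈ ℝ. Then the improper integral ∫₀^∞ (exp(i·u·x) - 1 - i·u·x)·exp(-M·x)·x^{-1-Y} dx converges and equals Γ(-Y)·((M - i·u)^Y - M^Y + i·u·Y·M^{Y-1}), where Γ is the real Gamma function extended to negative non-integer arguments and the complex power (M - i·u)^Y is taken with the principal branch. -/
open MeasureTheory Set Filter Topology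

theorem norm_exp_I_mul_sub_one_le (u x : ℝ) :
    ‖Complex.exp (Complex.I * u * x) - 1‖ ≤ |u| * |x| := by
  have h := Real.norm_exp_I_mul_ofReal_sub_one_le (x := u * x)
  rw [Real.norm_eq_abs, abs_mul] at h
  simpa [mul_assoc] using h

theorem norm_exp_I_mul_sub_one_sub_le (u x : ℝ) :
    ‖Complex.exp (Complex.I * u * x) - 1 - Complex.I * u * x‖ ≤ 2 * (|u| * |x|) := by
  have h : ‖Complex.I * (u : ℂ) * x‖ = |u| * |x| := by simp
  linarith [norm_sub_le (Complex.exp (Complex.I * u * x) - 1) (Complex.I * u * x),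
    norm_exp_I_mul_sub_one_le u x]

theorem norm_exp_I_mul_sub_one_sub_le_sq (u x : ℝ) :
    ‖Complex.exp (Complex.I * u * x) - 1 - Complex.I * u * x‖ ≤ 2 * (|u| * |x|) ^ 2 := by
  have h : ‖Complex.I * (u : ℂ) * x‖ = |u| * |x| := by simp
  rcases le_total (|u| * |x|) 1 with h1 | h1
  · have := Complex.norm_exp_sub_one_sub_id_le (h ▸ h1)
    rw [h] at this
    nlinarith [sq_nonneg (|u| * |x|)]
  · nlinarith [norm_exp_I_mul_sub_one_sub_le u x]

theorem integrableOn_exp_neg_mul_mul_rpow {M s : ℝ} (hM : 0 < M) (hs : -1 < s) :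
    IntegrableOn (fun x : ℝ => Real.exp (-M * x) * x ^ s) (Ioi 0) := by
  simpa [mul_comm] using integrableOn_rpow_mul_exp_neg_mul_rpow hs one_pos hM

theorem aestronglyMeasurable_mul_exp_mul_rpow {f : ℝ → ℂ} (hf : Continuous f) (M s : ℝ) :
    AEStronglyMeasurable (fun x : ℝ => f x * ((Real.exp (-M * x) * x ^ s : ℝ) : ℂ))
      (volume.restrict (Ioi 0)) := by
  have : Measurable fun x : ℝ => f x * ((Real.exp (-M * x) * x ^ s : ℝ) : ℂ) := by
    have := hf.measurable
    fun_prop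
  exact this.aestronglyMeasurable

/-- The compensated one-sided tempered-stable integrand is integrable, also without tempering. -/
theorem integrableOn_compensated_stable {M Y : ℝ} (hM : 0 ≤ M) (hY1 : 1 < Y) (hY2 : Y < 2)
    (u : ℝ) :
    IntegrableOn (fun x : ℝ =>
      (Complex.exp (Complex.I * (u : ℂ) * (x : ℂ)) - 1 - Complex.I * (u : ℂ) * (x : ℂ))
        * ((Real.exp (-M * x) * x ^ (-1 - Y) : ℝ) : ℂ)) (Ioi 0) := by
  have hmeas := aestronglyMeasurable_mul_exp_mul_rpow
    (f := fun x : ℝ => Complex.exp (Complex.I * u * x) - 1 - Complex.I * u * x)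
    (by fun_prop) M (-1 - Y)
  have hexp : ∀ x : ℝ, 0 < x → Real.exp (-M * x) ≤ 1 := fun x hx => by
    rw [Real.exp_le_one_iff]; nlinarith
  rw [← Ioc_union_Ioi_eq_Ioi (zero_le_one (α := ℝ)), integrableOn_union]
  constructor
  · have hi : IntegrableOn (fun x : ℝ => 2 * |u| ^ 2 * x ^ (1 - Y)) (Ioc 0 1) := by
      rw [integrableOn_Ioc_iff_integrableOn_Ioo]
      exact ((intervalIntegral.integrableOn_Ioo_rpow_iff one_pos).2 (by linarith)).const_mul _
    refine hi.mono' (hmeas.mono_measure (Measure.restrict_mono Ioc_subset_Ioi_self le_rfl)) ?_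
    refine ae_restrict_of_forall_mem measurableSet_Ioc fun x hx => ?_
    have hx0 := hx.1
    rw [norm_mul, Complex.norm_real, Real.norm_of_nonneg (by positivity)]
    calc _ ≤ 2 * (|u| * |x|) ^ 2 * (1 * x ^ (-1 - Y)) := by
          gcongr
          · exact norm_exp_I_mul_sub_one_sub_le_sq u x
          · exact hexp x hx0
      _ = _ := by
          rw [abs_of_pos hx0, show 1 - Y = 2 + (-1 - Y) by ring, Real.rpow_add hx0, Real.rpow_two]
          ring
  · have hi : IntegrableOn (fun x : ℝ => 2 * |u| * x ^ (-Y)) (Ioi 1) :=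
      (integrableOn_Ioi_rpow_of_lt (by linarith) one_pos).const_mul _
    refine hi.mono' (hmeas.mono_measure
      (Measure.restrict_mono (Ioi_subset_Ioi zero_le_one) le_rfl)) ?_
    refine ae_restrict_of_forall_mem measurableSet_Ioi fun x hx => ?_
    have hx0 : 0 < x := one_pos.trans hx
    rw [norm_mul, Complex.norm_real, Real.norm_of_nonneg (by positivity)]
    calc _ ≤ 2 * (|u| * |x|) * (1 * x ^ (-1 - Y)) := by
          gcongr
          · exact norm_exp_I_mul_sub_one_sub_le u x
          · exact hexp x hx0
      _ = _ := by
          rw [abs_of_pos hx0, show -Y = 1 + (-1 - Y) by ring, Real.rpow_add hx0, Real.rpow_one]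
          ring

theorem norm_exp_I_mul_sub_one_mul_exp_mul_rpow_le {M Y x : ℝ} (hx : 0 < x) (u : ℝ) :
    ‖(Complex.exp (Complex.I * u * x) - 1) * ((Real.exp (-M * x) * x ^ (-Y) : ℝ) : ℂ)‖
      ≤ |u| * (Real.exp (-M * x) * x ^ (1 - Y)) := by
  rw [norm_mul, Complex.norm_real, Real.norm_of_nonneg (by positivity)]
  calc _ ≤ |u| * |x| * (Real.exp (-M * x) * x ^ (-Y)) := by
        gcongr
        exact norm_exp_I_mul_sub_one_le u x
    _ = _ := by
        rw [abs_of_pos hx, sub_eq_add_neg, Real.rpow_add hx, Real.rpow_one]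
        ring

theorem integrableOn_exp_I_mul_sub_one_mul_exp_mul_rpow {M Y : ℝ} (hM : 0 < M) (hY2 : Y < 2)
    (u : ℝ) :
    IntegrableOn (fun x : ℝ =>
      (Complex.exp (Complex.I * u * x) - 1) * ((Real.exp (-M * x) * x ^ (-Y) : ℝ) : ℂ))
      (Ioi 0) :=
  ((integrableOn_exp_neg_mul_mul_rpow hM (by linarith : -1 < 1 - Y)).const_mul |u|).mono'
    (aestronglyMeasurable_mul_exp_mul_rpow
      (f := fun x : ℝ => Complex.exp (Complex.I * u * x) - 1) (by fun_prop) M (-Y))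
    (ae_restrict_of_forall_mem measurableSet_Ioi fun _ hx =>
      norm_exp_I_mul_sub_one_mul_exp_mul_rpow_le hx u)

/-- Differentiation of the compensated integral in the frequency `u`. -/
theorem hasDerivAt_integral_compensated_stable {M Y : ℝ} (hM : 0 < M) (hY1 : 1 < Y) (hY2 : Y < 2)
    (u : ℝ) :
    HasDerivAt (fun u : ℝ => ∫ x in Ioi (0 : ℝ),
      (Complex.exp (Complex.I * (u : ℂ) * (x : ℂ)) - 1 - Complex.I * (u : ℂ) * (x : ℂ))
        * ((Real.exp (-M * x) * x ^ (-1 - Y) : ℝ) : ℂ))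
      (Complex.I * ∫ x in Ioi (0 : ℝ),
        (Complex.exp (Complex.I * u * x) - 1) * ((Real.exp (-M * x) * x ^ (-Y) : ℝ) : ℂ)) u := by
  rw [← integral_const_mul]
  refine (hasDerivAt_integral_of_dominated_loc_of_deriv_le
    (F' := fun (u : ℝ) (x : ℝ) => Complex.I *
      ((Complex.exp (Complex.I * u * x) - 1) * ((Real.exp (-M * x) * x ^ (-Y) : ℝ) : ℂ)))
    (bound := fun x => (|u| + 1) * (Real.exp (-M * x) * x ^ (1 - Y)))
    (Metric.ball_mem_nhds u one_pos) (.of_forall fun v =>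
      (integrableOn_compensated_stable hM.le hY1 hY2 v).aestronglyMeasurable)
    (integrableOn_compensated_stable hM.le hY1 hY2 u)
    ((integrableOn_exp_I_mul_sub_one_mul_exp_mul_rpow hM hY2 u).aestronglyMeasurable.const_mul _)
    (ae_restrict_of_forall_mem measurableSet_Ioi fun x hx v hv => ?_)
    ((integrableOn_exp_neg_mul_mul_rpow hM (by linarith)).const_mul _)
    (ae_restrict_of_forall_mem measurableSet_Ioi fun x hx v _ => ?_)).2
  · rw [norm_mul, Complex.norm_I, one_mul]
    have hx0 : 0 < x := hx
    refine (norm_exp_I_mul_sub_one_mul_exp_mul_rpow_le hx v).trans ?_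
    have : |v| ≤ |u| + 1 := by
      rw [Metric.mem_ball, Real.dist_eq] at hv
      linarith [abs_sub_abs_le_abs_sub v u]
    gcongr
  · have hx0 : 0 < x := hx
    have h1 : HasDerivAt (fun v : ℝ => Complex.I * (v : ℂ) * (x : ℂ)) (Complex.I * x) v := by
      simpa using ((Complex.ofRealCLM.hasDerivAt (x := v)).const_mul Complex.I).mul_const (x : ℂ)
    refine (((h1.cexp.sub_const 1).sub h1).mul_const _).congr_deriv ?_
    rw [show -Y = 1 + (-1 - Y) by ring, Real.rpow_add hx0, Real.rpow_one]
    push_cast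
    ring

theorem integral_exp_neg_mul_mul_rpow {M Y : ℝ} (hM : 0 < M) (hY2 : Y < 2) :
    ∫ x in Ioi (0 : ℝ), ((Real.exp (-M * x) * x ^ (1 - Y) : ℝ) : ℂ)
      = ((Real.Gamma (2 - Y) * M ^ (Y - 2) : ℝ) : ℂ) := by
  rw [integral_complex_ofReal]
  have h := Real.integral_rpow_mul_exp_neg_mul_Ioi (by linarith : 0 < 2 - Y) hM
  rw [one_div, Real.inv_rpow hM.le, ← Real.rpow_neg hM.le, neg_sub] at h
  rw [mul_comm (Real.Gamma _), ← h]
  congr 1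
  refine setIntegral_congr_fun measurableSet_Ioi fun x _ => ?_
  rw [mul_comm, neg_mul, show 1 - Y = 2 - Y - 1 by ring]

/-- Integration by parts turns the compensated integral into a first-order linear differential
equation in `u`. -/
theorem integral_compensated_stable_by_parts {M Y : ℝ} (hM : 0 < M) (hY1 : 1 < Y) (hY2 : Y < 2)
    (u : ℝ) :
    Y * ∫ x in Ioi (0 : ℝ),
      (Complex.exp (Complex.I * (u : ℂ) * (x : ℂ)) - 1 - Complex.I * (u : ℂ) * (x : ℂ))
        * ((Real.exp (-M * x) * x ^ (-1 - Y) : ℝ) : ℂ)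
      = Complex.I * (M - Complex.I * u) * (Complex.I * ∫ x in Ioi (0 : ℝ),
        (Complex.exp (Complex.I * u * x) - 1) * ((Real.exp (-M * x) * x ^ (-Y) : ℝ) : ℂ))
        + Complex.I * u * M * ((Real.Gamma (2 - Y) * M ^ (Y - 2) : ℝ) : ℂ) := by
  have hh := integrableOn_exp_I_mul_sub_one_mul_exp_mul_rpow hM hY2 u
  have hg : IntegrableOn (fun x : ℝ => ((Real.exp (-M * x) * x ^ (1 - Y) : ℝ) : ℂ)) (Ioi 0) :=
    (integrableOn_exp_neg_mul_mul_rpow hM (by linarith)).ofReal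
  have hf := integrableOn_compensated_stable hM.le hY1 hY2 u
  let φ : ℝ → ℂ := fun x =>
    (Complex.exp (Complex.I * u * x) - 1 - Complex.I * u * x) * (Real.exp (-M * x) : ℝ)
  let φ' : ℝ → ℂ := fun x =>
    Complex.I * u * (Complex.exp (Complex.I * u * x) - 1) * (Real.exp (-M * x) : ℝ) - M * φ x
  let v : ℝ → ℂ := fun x => ((x ^ (-Y) : ℝ) : ℂ)
  let v' : ℝ → ℂ := fun x => ((-Y * x ^ (-1 - Y) : ℝ) : ℂ)
  have hφ : ∀ x ∈ Ioi (0 : ℝ), HasDerivAt φ (φ' x) x := fun x _ => by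
    have h1 : HasDerivAt (fun x : ℝ => Complex.I * (u : ℂ) * (x : ℂ)) (Complex.I * u) x := by
      simpa using (Complex.ofRealCLM.hasDerivAt (x := x)).const_mul (Complex.I * (u : ℂ))
    have h2 : HasDerivAt (fun x : ℝ => ((Real.exp (-M * x) : ℝ) : ℂ))
        ((Real.exp (-M * x) * -M : ℝ) : ℂ) x := by
      simpa using (((hasDerivAt_id x).const_mul (-M)).exp).ofReal_comp
    refine (((h1.cexp.sub_const 1).sub h1).mul h2).congr_deriv ?_
    simp only [φ', φ, Pi.sub_apply]
    push_cast
    ring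
  have hv : ∀ x ∈ Ioi (0 : ℝ), HasDerivAt v (v' x) x := fun x hx => by
    have := (Real.hasDerivAt_rpow_const (p := -Y) (Or.inl (ne_of_gt hx))).ofReal_comp
    rwa [show -Y - 1 = -1 - Y by ring] at this
  have e1 : ∀ x ∈ Ioi (0 : ℝ), -Y * ((Complex.exp (Complex.I * u * x) - 1 - Complex.I * u * x)
      * ((Real.exp (-M * x) * x ^ (-1 - Y) : ℝ) : ℂ)) = (φ * v') x := fun x _ => by
    simp only [φ, v', Pi.mul_apply]
    push_cast
    ring
  have e2 : ∀ x ∈ Ioi (0 : ℝ), Complex.I * u * ((Complex.exp (Complex.I * u * x) - 1)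
      * ((Real.exp (-M * x) * x ^ (-Y) : ℝ) : ℂ)) - M * ((Complex.exp (Complex.I * u * x) - 1)
      * ((Real.exp (-M * x) * x ^ (-Y) : ℝ) : ℂ)) +
      Complex.I * u * M * ((Real.exp (-M * x) * x ^ (1 - Y) : ℝ) : ℂ) = (φ' * v) x := fun x hx => by
    have hx0 : 0 < x := hx
    simp only [φ, φ', v, Pi.mul_apply]
    rw [sub_eq_add_neg 1 Y, Real.rpow_add hx0, Real.rpow_one]
    push_cast
    ring
  have hbound : ∀ x : ℝ, 0 < x → ‖(φ * v) x‖ ≤ 2 * |u| ^ 2 * x ^ (2 - Y) ∧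
      ‖(φ * v) x‖ ≤ 2 * |u| * x ^ (-(Y - 1)) := fun x hx => by
    have hb : ‖(φ * v) x‖ ≤ ‖Complex.exp (Complex.I * u * x) - 1 - Complex.I * u * x‖
        * x ^ (-Y) := by
      simp only [φ, v, Pi.mul_apply, norm_mul, Complex.norm_real]
      rw [Real.norm_of_nonneg (Real.exp_pos _).le, Real.norm_of_nonneg (by positivity)]
      have : Real.exp (-M * x) ≤ 1 := by rw [Real.exp_le_one_iff]; nlinarith
      gcongr
      exact mul_le_of_le_one_right (norm_nonneg _) this
    have hp : 0 ≤ x ^ (-Y) := by positivity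
    constructor
    · refine hb.trans ((mul_le_mul_of_nonneg_right
        (norm_exp_I_mul_sub_one_sub_le_sq u x) hp).trans_eq ?_)
      rw [abs_of_pos hx, sub_eq_add_neg 2 Y, Real.rpow_add hx, Real.rpow_two]
      ring
    · refine hb.trans ((mul_le_mul_of_nonneg_right
        (norm_exp_I_mul_sub_one_sub_le u x) hp).trans_eq ?_)
      rw [abs_of_pos hx, show -(Y - 1) = 1 + -Y by ring, Real.rpow_add hx, Real.rpow_one]
      ring
  have h0 : Tendsto (φ * v) (𝓝[>] 0) (𝓝 0) := by
    have ht : Tendsto (fun x : ℝ => 2 * |u| ^ 2 * x ^ (2 - Y)) (𝓝[>] 0) (𝓝 0) := by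
      have : ContinuousAt (fun x : ℝ => 2 * |u| ^ 2 * x ^ (2 - Y)) 0 :=
        (Real.continuousAt_rpow_const 0 (2 - Y) (Or.inr (by linarith))).const_mul _
      have := this.tendsto
      rw [Real.zero_rpow (by linarith), mul_zero] at this
      exact this.mono_left nhdsWithin_le_nhds
    exact squeeze_zero_norm' (eventually_mem_nhdsWithin.mono fun x hx => (hbound x hx).1) ht
  have hinf : Tendsto (φ * v) atTop (𝓝 0) := by
    have ht := (tendsto_rpow_neg_atTop (by linarith : 0 < Y - 1)).const_mul (2 * |u|)
    rw [mul_zero] at ht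
    exact squeeze_zero_norm' ((eventually_gt_atTop 0).mono fun x hx => (hbound x hx).2) ht
  have hparts := integral_Ioi_mul_deriv_eq_deriv_mul hφ hv
    (IntegrableOn.congr_fun (hf.const_mul (-Y : ℂ)) e1 measurableSet_Ioi)
    (IntegrableOn.congr_fun (((hh.const_mul (Complex.I * u)).sub (hh.const_mul (M : ℂ))).add
      (hg.const_mul (Complex.I * u * M))) e2 measurableSet_Ioi) h0 hinf
  have i1 := setIntegral_congr_fun (μ := volume) measurableSet_Ioi e1
  have i2 := setIntegral_congr_fun (μ := volume) measurableSet_Ioi e2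
  simp only [Pi.mul_apply] at i1 i2
  rw [← i1, ← i2, integral_const_mul, integral_add
    (f := fun x : ℝ => Complex.I * u * ((Complex.exp (Complex.I * u * x) - 1)
      * ((Real.exp (-M * x) * x ^ (-Y) : ℝ) : ℂ)) - M * ((Complex.exp (Complex.I * u * x) - 1)
      * ((Real.exp (-M * x) * x ^ (-Y) : ℝ) : ℂ)))
    ((hh.const_mul _).sub (hh.const_mul _)) (hg.const_mul _),
    integral_sub (hh.const_mul _) (hh.const_mul _), integral_const_mul,
    integral_const_mul, integral_const_mul, integral_exp_neg_mul_mul_rpow hM hY2] at hparts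
  linear_combination -hparts - (M - Complex.I * u) * (∫ x in Ioi (0 : ℝ),
    (Complex.exp (Complex.I * u * x) - 1) * ((Real.exp (-M * x) * x ^ (-Y) : ℝ) : ℂ))
    * Complex.I_sq

/-- The closed form under genuine tempering, by uniqueness for the differential equation. -/
theorem integral_compensated_stable_of_pos {M Y : ℝ} (hM : 0 < M) (hY1 : 1 < Y) (hY2 : Y < 2)
    (u : ℝ) :
    ∫ x in Ioi (0 : ℝ),
      (Complex.exp (Complex.I * (u : ℂ) * (x : ℂ)) - 1 - Complex.I * (u : ℂ) * (x : ℂ))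
        * ((Real.exp (-M * x) * x ^ (-1 - Y) : ℝ) : ℂ)
      = ((Real.Gamma (-Y) : ℝ) : ℂ) *
          (((M : ℂ) - Complex.I * (u : ℂ)) ^ (Y : ℂ) - ((M ^ Y : ℝ) : ℂ)
            + Complex.I * (u : ℂ) * (Y : ℂ) * ((M ^ (Y - 1) : ℝ) : ℂ)) := by
  let F : ℝ → ℂ := fun u => ∫ x in Ioi (0 : ℝ),
      (Complex.exp (Complex.I * (u : ℂ) * (x : ℂ)) - 1 - Complex.I * (u : ℂ) * (x : ℂ))
        * ((Real.exp (-M * x) * x ^ (-1 - Y) : ℝ) : ℂ)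
  let G : ℝ → ℂ := fun u => ((Real.Gamma (-Y) : ℝ) : ℂ) *
          (((M : ℂ) - Complex.I * (u : ℂ)) ^ (Y : ℂ) - ((M ^ Y : ℝ) : ℂ)
            + Complex.I * (u : ℂ) * (Y : ℂ) * ((M ^ (Y - 1) : ℝ) : ℂ))
  have hslit : ∀ u : ℝ, (M : ℂ) - Complex.I * u ∈ Complex.slitPlane := fun u =>
    Or.inl (by simpa using hM)
  have hz : ∀ u : ℝ, (M : ℂ) - Complex.I * u ≠ 0 := fun u =>
    Complex.slitPlane_ne_zero (hslit u)
  have hΓ : Real.Gamma (2 - Y) = Y * (Y - 1) * Real.Gamma (-Y) := by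
    have h1 := Real.Gamma_add_one (s := -Y) (by linarith)
    have h2 := Real.Gamma_add_one (s := -Y + 1) (by linarith)
    rw [show 2 - Y = -Y + 1 + 1 by ring, h2, h1]
    ring
  have hlin : ∀ u : ℝ, HasDerivAt (fun u : ℝ => Complex.I * (u : ℂ)) Complex.I u := fun u => by
    simpa using (Complex.ofRealCLM.hasDerivAt (x := u)).const_mul Complex.I
  have hpow : ∀ (s : ℂ) (u : ℝ), HasDerivAt (fun u : ℝ => ((M : ℂ) - Complex.I * u) ^ s)
      (s * ((M : ℂ) - Complex.I * u) ^ (s - 1) * -Complex.I) u := fun s u =>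
    HasDerivAt.comp (h₂ := fun z : ℂ => z ^ s) u
      (Complex.hasStrictDerivAt_cpow_const (hslit u)).hasDerivAt ((hlin u).const_sub (M : ℂ))
  have hG : ∀ u : ℝ, HasDerivAt G (((Real.Gamma (-Y) : ℝ) : ℂ) *
      (Y * ((M : ℂ) - Complex.I * u) ^ ((Y : ℂ) - 1) * -Complex.I
        + Complex.I * (Y : ℂ) * ((M ^ (Y - 1) : ℝ) : ℂ))) u := fun u =>
    (((hpow Y u).sub_const _).add (((hlin u).mul_const (Y : ℂ)).mul_const _)).const_mul _
  have hF := hasDerivAt_integral_compensated_stable hM hY1 hY2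
  have hD : ∀ u : ℝ, HasDerivAt (fun u : ℝ => (F u - G u) * ((M : ℂ) - Complex.I * u) ^ (-Y : ℂ))
      0 u := fun u => by
    refine (((hF u).sub (hG u)).mul (hpow (-Y) u)).congr_deriv ?_
    have hode := integral_compensated_stable_by_parts hM hY1 hY2 u
    change (Y : ℂ) * F u = _ at hode
    generalize (∫ x in Ioi (0 : ℝ),
        (Complex.exp (Complex.I * u * x) - 1) * ((Real.exp (-M * x) * x ^ (-Y) : ℝ) : ℂ)) = D
      at hode ⊢
    simp only [Pi.sub_apply, G]
    have e1 : M ^ Y = M * M ^ (Y - 1) := by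
      rw [Real.rpow_sub_one hM.ne']; field_simp
    have e2 : M ^ (Y - 1) = M * M ^ (Y - 2) := by
      rw [show Y - 1 = Y - 2 + 1 by ring, Real.rpow_add_one hM.ne']; ring
    have e3 : ((M : ℂ) - Complex.I * u) ^ (Y : ℂ)
        = ((M : ℂ) - Complex.I * u) ^ ((Y : ℂ) - 1) * ((M : ℂ) - Complex.I * u) := by
      rw [Complex.cpow_sub _ _ (hz u), Complex.cpow_one, div_mul_cancel₀ _ (hz u)]
    have e4 : ((M : ℂ) - Complex.I * u) ^ (-Y : ℂ)
        = ((M : ℂ) - Complex.I * u) ^ (-(Y : ℂ) - 1) * ((M : ℂ) - Complex.I * u) := by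
      rw [Complex.cpow_sub _ _ (hz u), Complex.cpow_one, div_mul_cancel₀ _ (hz u)]
    rw [e1, e2, e3, e4]
    rw [hΓ] at hode
    simp only [F] at hode
    generalize (∫ x in Ioi (0 : ℝ),
      (Complex.exp (Complex.I * (u : ℂ) * (x : ℂ)) - 1 - Complex.I * (u : ℂ) * (x : ℂ))
        * ((Real.exp (-M * x) * x ^ (-1 - Y) : ℝ) : ℂ)) = W at hode ⊢
    push_cast at hode ⊢
    generalize ((M : ℂ) - Complex.I * u) ^ (-(Y : ℂ) - 1) = R
    generalize ((M : ℂ) - Complex.I * u) ^ ((Y : ℂ) - 1) = Q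
    linear_combination Complex.I * R * hode
      + Complex.I * R * ((M : ℂ) - Complex.I * u) * D * Complex.I_sq
  have hconst := is_const_of_deriv_eq_zero (fun u => (hD u).differentiableAt)
    (fun u => (hD u).deriv) u 0
  have hzero : F 0 - G 0 = 0 := by
    simp [F, G, Complex.ofReal_cpow hM.le]
  rw [hzero, zero_mul] at hconst
  exact sub_eq_zero.1 ((mul_eq_zero.1 hconst).resolve_right
    (by simp [Complex.cpow_eq_zero_iff, hz u]))

/-- One-sided tempered-stable Lévy–Khintchine integral: for `Y ∈ (1,2)`,
`M ≥ 0`, and `u ∈ ℝ`,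
`∫₀^∞ (exp(iux) - 1 - iux)·e^{-Mx}·x^{-1-Y} dx
  = Γ(-Y)·((M - iu)^Y - M^Y + iuY·M^{Y-1})`. -/
theorem stmt15 (M Y u : ℝ) (hM : 0 ≤ M) (hY1 : 1 < Y) (hY2 : Y < 2) :
    IntegrableOn
      (fun x : ℝ =>
        (Complex.exp (Complex.I * (u : ℂ) * (x : ℂ)) - 1 - Complex.I * (u : ℂ) * (x : ℂ))
          * ((Real.exp (-M * x) * x ^ (-1 - Y) : ℝ) : ℂ))
      (Set.Ioi 0) ∧
    ∫ x in Set.Ioi (0 : ℝ),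
        (Complex.exp (Complex.I * (u : ℂ) * (x : ℂ)) - 1 - Complex.I * (u : ℂ) * (x : ℂ))
          * ((Real.exp (-M * x) * x ^ (-1 - Y) : ℝ) : ℂ)
      = ((Real.Gamma (-Y) : ℝ) : ℂ) *
          (((M : ℂ) - Complex.I * (u : ℂ)) ^ (Y : ℂ) - ((M ^ Y : ℝ) : ℂ)
            + Complex.I * (u : ℂ) * (Y : ℂ) * ((M ^ (Y - 1) : ℝ) : ℂ)) := by
  refine ⟨integrableOn_compensated_stable hM hY1 hY2 u, ?_⟩
  rcases hM.eq_or_lt with rfl | hM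
  swap
  · exact integral_compensated_stable_of_pos hM hY1 hY2 u
  have hint := (integrableOn_compensated_stable le_rfl hY1 hY2 u).norm
  have hL : Tendsto (fun M : ℝ => ∫ x in Set.Ioi (0 : ℝ),
      (Complex.exp (Complex.I * (u : ℂ) * (x : ℂ)) - 1 - Complex.I * (u : ℂ) * (x : ℂ))
        * ((Real.exp (-M * x) * x ^ (-1 - Y) : ℝ) : ℂ)) (𝓝[>] 0) (𝓝 (∫ x in Set.Ioi (0 : ℝ),
      (Complex.exp (Complex.I * (u : ℂ) * (x : ℂ)) - 1 - Complex.I * (u : ℂ) * (x : ℂ))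
        * ((Real.exp (-0 * x) * x ^ (-1 - Y) : ℝ) : ℂ))) := by
    refine tendsto_integral_filter_of_dominated_convergence _
      (eventually_mem_nhdsWithin.mono fun m hm =>
        (integrableOn_compensated_stable (le_of_lt hm) hY1 hY2 u).aestronglyMeasurable)
      (eventually_mem_nhdsWithin.mono fun m hm =>
        ae_restrict_of_forall_mem measurableSet_Ioi fun x hx => ?_) hint
      (ae_restrict_of_forall_mem measurableSet_Ioi fun x hx => ?_)
    · have hx0 : 0 < x := hx
      have hm0 : 0 < m := hm
      rw [norm_mul, norm_mul, Complex.norm_real, Complex.norm_real,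
        Real.norm_of_nonneg (by positivity), Real.norm_of_nonneg (by positivity)]
      gcongr
    · refine Tendsto.mono_left (Continuous.tendsto' ?_ _ _ rfl) nhdsWithin_le_nhds
      fun_prop
  have hrpow : ∀ s : ℝ, 0 < s → ContinuousAt (fun M : ℝ => ((M ^ s : ℝ) : ℂ)) 0 := fun s hs =>
    Complex.continuous_ofReal.continuousAt.comp
      (Real.continuousAt_rpow_const 0 s (Or.inr hs.le))
  have hcpow : ContinuousAt (fun M : ℝ => ((M : ℂ) - Complex.I * (u : ℂ)) ^ (Y : ℂ)) 0 :=
    ContinuousAt.comp (g := fun z : ℂ => z ^ (Y : ℂ))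
      (Complex.continuousAt_cpow_const_of_re_pos (by simp) (by simpa using by linarith))
      (by fun_prop)
  have hR : ContinuousAt (fun M : ℝ => ((Real.Gamma (-Y) : ℝ) : ℂ) *
      (((M : ℂ) - Complex.I * (u : ℂ)) ^ (Y : ℂ) - ((M ^ Y : ℝ) : ℂ)
        + Complex.I * (u : ℂ) * (Y : ℂ) * ((M ^ (Y - 1) : ℝ) : ℂ))) 0 :=
    ((hcpow.sub (hrpow Y (by linarith))).add
      ((hrpow (Y - 1) (by linarith)).const_mul _)).const_mul _
  refine tendsto_nhds_unique hL ((hR.tendsto.mono_left nhdsWithin_le_nhds).congr' ?_)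
  exact eventually_mem_nhdsWithin.mono fun m hm =>
    (integral_compensated_stable_of_pos hm hY1 hY2 u).symm
end
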